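/- Let m, n, r be natural numbers with m ≥ 1 and m + n ≥ r + 4, and for k > 0 define 𝓘_{m,n,r}(k) = ∫_{−∞}^{∞} e^{−i k z} y(z)^r (y(z) + 2i)^{−m} (y(z) − 2i)^{−n} dz. Then there exist constants C > 0 and k₀ > 0 such that for all k ≥ k₀, |𝓘_{m,n,r}(k) − i^{3(r−n)−m} · 2^{r−2n+1} · 3^{m/2} · (π/Γ(m/2)) · e^{−8k} · k^{(m−2)/2}| ≤ C k^{(m−3)/2} e^{−8k}, where Γ is the Gamma function and i^{3(r−n)−m} denotes the (possibly negative) integer power of the imaginary unit. -/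

import Mathlib

open MeasureTheory

/-- `y(z) = (√(z² + 64) + z)^{1/3} − (√(z² + 64) − z)^{1/3}`. -/
noncomputable def yy (z : ℝ) : ℝ :=
  (Real.sqrt (z ^ 2 + 64) + z) ^ ((1 : ℝ) / 3) - (Real.sqrt (z ^ 2 + 64) - z) ^ ((1 : ℝ) / 3)

lemma yy_cubic (z : ℝ) : yy z ^ 3 + 12 * yy z = 2 * z := by
  have hs : Real.sqrt (z ^ 2 + 64) ^ 2 = z ^ 2 + 64 := Real.sq_sqrt (by positivity)
  have hlt : |z| < Real.sqrt (z ^ 2 + 64) := by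
    rw [← Real.sqrt_sq_eq_abs]
    exact Real.sqrt_lt_sqrt (sq_nonneg z) (by linarith)
  obtain ⟨h1, h2⟩ := abs_lt.1 hlt
  have hp : 0 ≤ Real.sqrt (z ^ 2 + 64) + z := by linarith
  have hq : 0 ≤ Real.sqrt (z ^ 2 + 64) - z := by linarith
  have cube : ∀ x : ℝ, 0 ≤ x → (x ^ ((1 : ℝ) / 3)) ^ 3 = x := fun x hx => by
    rw [← Real.rpow_natCast, ← Real.rpow_mul hx]; norm_num
  have hab : (Real.sqrt (z ^ 2 + 64) + z) ^ ((1 : ℝ) / 3) *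
      (Real.sqrt (z ^ 2 + 64) - z) ^ ((1 : ℝ) / 3) = 4 := by
    rw [← Real.mul_rpow hp hq,
      show (Real.sqrt (z ^ 2 + 64) + z) * (Real.sqrt (z ^ 2 + 64) - z) = (4 : ℝ) ^ (3 : ℝ) by
        norm_num; linear_combination hs,
      ← Real.rpow_mul (by norm_num)]
    norm_num
  have ha := cube _ hp
  have hb := cube _ hq
  unfold yy
  generalize (Real.sqrt (z ^ 2 + 64) + z) ^ ((1 : ℝ) / 3) = a at *
  generalize (Real.sqrt (z ^ 2 + 64) - z) ^ ((1 : ℝ) / 3) = b at *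
  linear_combination ha - hb - 3 * (a - b) * hab

lemma cubic_injective : Function.Injective fun y : ℝ => (y ^ 3 + 12 * y) / 2 := by
  intro a b h
  have h' : (a - b) * (a ^ 2 + a * b + b ^ 2 + 12) = 0 := by
    simp only at h; linear_combination 2 * h
  rcases mul_eq_zero.1 h' with h0 | h0
  · linarith
  · nlinarith [sq_nonneg (a + b), sq_nonneg a, sq_nonneg b]

lemma cubic_yy (z : ℝ) : (yy z ^ 3 + 12 * yy z) / 2 = z := by rw [yy_cubic]; ring

lemma yy_cubic_apply (y : ℝ) : yy ((y ^ 3 + 12 * y) / 2) = y := cubic_injective (cubic_yy _)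

lemma integral_comp_yy (g : ℝ → ℝ → ℂ) :
    ∫ z, g z (yy z) = ∫ y : ℝ, ((3 * (y ^ 2 + 4) / 2 : ℝ) : ℂ) * g ((y ^ 3 + 12 * y) / 2) y := by
  have himg : (fun y : ℝ => (y ^ 3 + 12 * y) / 2) '' Set.univ = Set.univ :=
    Set.image_univ_of_surjective fun z => ⟨yy z, cubic_yy z⟩
  have hd : ∀ y ∈ (Set.univ : Set ℝ), HasDerivWithinAt (fun y : ℝ => (y ^ 3 + 12 * y) / 2)
      (3 * (y ^ 2 + 4) / 2) Set.univ y := fun y _ => by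
    have := (((hasDerivAt_pow 3 y).add ((hasDerivAt_id y).const_mul 12)).div_const 2)
    refine (this.congr_deriv ?_).hasDerivWithinAt
    norm_num; ring
  have := integral_image_eq_integral_abs_deriv_smul MeasurableSet.univ hd
    cubic_injective.injOn (fun z => g z (yy z))
  rw [himg] at this
  simp only [setIntegral_univ] at this
  rw [this]
  congr 1 with y
  rw [yy_cubic_apply, abs_of_nonneg (by positivity), Complex.real_smul]

lemma integral_horizontal_line_eq {f : ℂ → ℂ} {a b C : ℝ} (hab : a ≤ b)
    (hf : DifferentiableOn ℂ f (Complex.im ⁻¹' Set.Icc a b))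
    (hC : ∀ x : ℝ, ∀ s ∈ Set.Icc a b, ‖f (x + s * Complex.I)‖ ≤ C * (1 + x ^ 2)⁻¹) :
    ∫ x : ℝ, f (x + a * Complex.I) = ∫ x : ℝ, f (x + b * Complex.I) := by
  have hcont : ∀ s ∈ Set.Icc a b, Continuous fun x : ℝ => f (x + s * Complex.I) := fun s hs =>
    hf.continuousOn.comp_continuous (by fun_prop) fun x => by simpa using hs
  have hint : ∀ s ∈ Set.Icc a b, Integrable fun x : ℝ => f (x + s * Complex.I) := fun s hs =>
    (integrable_inv_one_add_sq.const_mul C).mono' (hcont s hs).aestronglyMeasurable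
      (Filter.Eventually.of_forall fun x => hC x s hs)
  have hlim : ∀ s ∈ Set.Icc a b, Filter.Tendsto
      (fun T : ℝ => ∫ x in (-T)..T, f (x + s * Complex.I)) Filter.atTop
      (nhds (∫ x : ℝ, f (x + s * Complex.I))) := fun s hs =>
    intervalIntegral_tendsto_integral (hint s hs) Filter.tendsto_neg_atTop_atBot Filter.tendsto_id
  have hzero : Filter.Tendsto (fun T : ℝ => C * (1 + T ^ 2)⁻¹ * |b - a|) Filter.atTop (nhds 0) := by
    have : Filter.Tendsto (fun T : ℝ => 1 + T ^ 2) Filter.atTop Filter.atTop :=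
      Filter.tendsto_atTop_add_const_left _ _ (Filter.tendsto_pow_atTop two_ne_zero)
    simpa using (this.inv_tendsto_atTop.const_mul C).mul_const |b - a|
  have hvert : ∀ T : ℝ, ‖∫ s in a..b, f ((T : ℂ) + s * Complex.I)‖ ≤ C * (1 + T ^ 2)⁻¹ * |b - a| :=
    fun T => intervalIntegral.norm_integral_le_of_norm_le_const fun s hs =>
      hC T s (by rw [Set.uIoc_of_le hab] at hs; exact ⟨hs.1.le, hs.2⟩)
  have hr := squeeze_zero_norm hvert hzero
  have hl : Filter.Tendsto (fun T : ℝ => ∫ s in a..b, f (((-T : ℝ) : ℂ) + s * Complex.I))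
      Filter.atTop (nhds 0) :=
    squeeze_zero_norm (fun T => (hvert (-T)).trans_eq (by rw [neg_sq])) hzero
  have hrect : ∀ T : ℝ, (∫ x in (-T)..T, f (x + a * Complex.I)) -
      (∫ x in (-T)..T, f (x + b * Complex.I)) +
      Complex.I • (∫ s in a..b, f ((T : ℂ) + s * Complex.I)) -
      Complex.I • (∫ s in a..b, f (((-T : ℝ) : ℂ) + s * Complex.I)) = 0 := fun T => by
    have := Complex.integral_boundary_rect_eq_zero_of_differentiableOn f ⟨-T, a⟩ ⟨T, b⟩
      (hf.mono fun z hz => by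
        have := hz.2
        rwa [Set.uIcc_of_le hab] at this)
    simpa using this
  have := (((hlim a ⟨le_rfl, hab⟩).sub (hlim b ⟨hab, le_rfl⟩)).add (hr.const_smul Complex.I)).sub
    (hl.const_smul Complex.I)
  have h0 := tendsto_nhds_unique this (by simp only [hrect]; exact tendsto_const_nhds)
  simpa [sub_eq_zero] using h0

lemma integrable_pow_mul_exp_neg_sq (N : ℕ) :
    Integrable fun t : ℝ => (5 + |t|) ^ N * Real.exp (3 - 3 / 2 * t ^ 2) := by
  have hg : Integrable fun t : ℝ => (N.factorial * Real.exp 9) * Real.exp (-1 * t ^ 2) :=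
    (integrable_exp_neg_mul_sq one_pos).const_mul _
  refine hg.mono' (by fun_prop) (Filter.Eventually.of_forall fun t => ?_)
  have h1 : (5 + |t|) ^ N ≤ N.factorial * Real.exp (5 + |t|) := by
    have := Real.pow_div_factorial_le_exp (x := 5 + |t|) (by positivity) N
    rwa [div_le_iff₀' (by positivity)] at this
  rw [Real.norm_of_nonneg (by positivity)]
  calc _ ≤ N.factorial * Real.exp (5 + |t|) * Real.exp (3 - 3 / 2 * t ^ 2) := by gcongr
    _ = N.factorial * Real.exp (5 + |t| + (3 - 3 / 2 * t ^ 2)) := by rw [mul_assoc, ← Real.exp_add]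
    _ ≤ N.factorial * Real.exp (9 + -1 * t ^ 2) := by
        refine mul_le_mul_of_nonneg_left (Real.exp_le_exp.2 ?_) (by positivity)
        nlinarith [sq_abs t, sq_nonneg (|t| - 1)]
    _ = _ := by rw [Real.exp_add]; ring

lemma ofReal_add_I_ne_zero (t : ℝ) : (t : ℂ) + Complex.I ≠ 0 := fun h => by
  simpa using congrArg Complex.im h

lemma norm_inv_ofReal_add_I_le (t : ℝ) : ‖((t : ℂ) + Complex.I)⁻¹‖ ≤ 1 := by
  rw [norm_inv]
  refine inv_le_one_of_one_le₀ ?_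
  simpa using Complex.abs_im_le_norm ((t : ℂ) + Complex.I)

lemma norm_ofReal_add_I_le (t : ℝ) : ‖(t : ℂ) + Complex.I‖ ≤ 1 + |t| :=
  (norm_add_le _ _).trans_eq (by simp [add_comm])

lemma norm_cexp_neg_three_sq (t : ℝ) :
    ‖Complex.exp (-3 * ((t : ℂ) + Complex.I) ^ 2)‖ = Real.exp (3 - 3 * t ^ 2) := by
  rw [Complex.norm_exp]
  congr 1
  simp [pow_two]
  ring

lemma integrable_gaussian_mul_inv_pow (p q : ℕ) : Integrable fun t : ℝ =>
    Complex.exp (-3 * ((t : ℂ) + Complex.I) ^ 2) *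
      (((t : ℂ) + Complex.I) ^ q * ((t : ℂ) + Complex.I)⁻¹ ^ p) := by
  refine (integrable_pow_mul_exp_neg_sq q).mono' ?_ (Filter.Eventually.of_forall fun t => ?_)
  · refine Continuous.aestronglyMeasurable ?_
    have : Continuous fun t : ℝ => ((t : ℂ) + Complex.I)⁻¹ :=
      Continuous.inv₀ (by fun_prop) ofReal_add_I_ne_zero
    fun_prop
  · rw [norm_mul, norm_mul, norm_pow, norm_pow, norm_cexp_neg_three_sq, mul_comm]
    have h1 := pow_le_one₀ (n := p) (norm_nonneg _) (norm_inv_ofReal_add_I_le t)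
    have h2 : ‖(t : ℂ) + Complex.I‖ ^ q ≤ (5 + |t|) ^ q := by
      gcongr; linarith [norm_ofReal_add_I_le t]
    have h3 : Real.exp (3 - 3 * t ^ 2) ≤ Real.exp (3 - 3 / 2 * t ^ 2) := by
      gcongr; norm_num
    calc _ ≤ (5 + |t|) ^ q * 1 * Real.exp (3 - 3 / 2 * t ^ 2) := by gcongr
      _ = _ := by ring

/-- `∫ e^{-3v²} v^{1-p} dv` along the line `Im v = 1`. -/
noncomputable def lineGaussian (p : ℕ) : ℂ :=
  ∫ t : ℝ, Complex.exp (-3 * ((t : ℂ) + Complex.I) ^ 2) *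
    (((t : ℂ) + Complex.I) * ((t : ℂ) + Complex.I)⁻¹ ^ p)

lemma lineGaussian_add_two (p : ℕ) : (p : ℂ) * lineGaussian (p + 2) = -6 * lineGaussian p := by
  have hderiv : ∀ t : ℝ, HasDerivAt
      (fun t : ℝ => Complex.exp (-3 * ((t : ℂ) + Complex.I) ^ 2) * ((t : ℂ) + Complex.I)⁻¹ ^ p)
      (-6 * (Complex.exp (-3 * ((t : ℂ) + Complex.I) ^ 2) *
        (((t : ℂ) + Complex.I) * ((t : ℂ) + Complex.I)⁻¹ ^ p)) -
      p * (Complex.exp (-3 * ((t : ℂ) + Complex.I) ^ 2) *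
        (((t : ℂ) + Complex.I) * ((t : ℂ) + Complex.I)⁻¹ ^ (p + 2)))) t := fun t => by
    have h0 := ofReal_add_I_ne_zero t
    have hv : HasDerivAt (fun t : ℝ => (t : ℂ) + Complex.I) 1 t :=
      (Complex.ofRealCLM.hasDerivAt (x := t)).add_const Complex.I
    refine ((((hv.pow 2).const_mul (-3)).cexp).mul ((hv.inv h0).pow p)).congr_deriv ?_
    simp only [Pi.pow_apply, Pi.inv_apply]
    generalize (t : ℂ) + Complex.I = v at *
    generalize Complex.exp (-3 * v ^ 2) = E
    rcases p with _ | p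
    · simp; ring
    · simp only [Nat.add_sub_cancel]
      simp only [inv_pow]
      push_cast
      field_simp
      ring
  have hi1 : Integrable fun t : ℝ => Complex.exp (-3 * ((t : ℂ) + Complex.I) ^ 2) *
      ((t : ℂ) + Complex.I)⁻¹ ^ p := by simpa using integrable_gaussian_mul_inv_pow p 0
  have hi : ∀ p : ℕ, Integrable fun t : ℝ => Complex.exp (-3 * ((t : ℂ) + Complex.I) ^ 2) *
      (((t : ℂ) + Complex.I) * ((t : ℂ) + Complex.I)⁻¹ ^ p) := fun p => by
    simpa using integrable_gaussian_mul_inv_pow p 1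
  have h := integral_eq_zero_of_hasDerivAt_of_integrable hderiv
    (((hi p).const_mul _).sub ((hi (p + 2)).const_mul _)) hi1
  rw [integral_sub ((hi p).const_mul _) ((hi (p + 2)).const_mul _), integral_const_mul,
    integral_const_mul] at h
  unfold lineGaussian
  linear_combination -h

lemma integral_cexp_neg_three_mul_sq (c : ℝ) :
    ∫ t : ℝ, Complex.exp (-3 * ((t : ℂ) + c * Complex.I) ^ 2) = (Real.sqrt (Real.pi / 3) : ℂ) := by
  rw [GaussianFourier.integral_cexp_neg_mul_sq_add_real_mul_I (by norm_num) c,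
    Real.sqrt_eq_rpow, Complex.ofReal_cpow (by positivity)]
  norm_num

lemma lineGaussian_one : lineGaussian 1 = (Real.sqrt (Real.pi / 3) : ℂ) := by
  rw [← integral_cexp_neg_three_mul_sq 1]
  unfold lineGaussian
  congr 1 with t
  simp [ofReal_add_I_ne_zero]

lemma lineGaussian_two : lineGaussian 2 = -Complex.I * Real.pi := by
  have hinv : ∀ t : ℝ, ((t : ℂ) + Complex.I)⁻¹ = -Complex.I *
      ∫ s in Set.Ioi (0 : ℝ), Complex.exp (Complex.I * ((t : ℂ) + Complex.I) * s) := fun t => by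
    rw [integral_exp_mul_complex_Ioi (by simp)]
    have := ofReal_add_I_ne_zero t
    simp only [Complex.ofReal_zero, mul_zero, Complex.exp_zero]
    field_simp
  have hint : Integrable (Function.uncurry fun (t s : ℝ) =>
      Complex.exp (-3 * ((t : ℂ) + Complex.I) ^ 2) *
        Complex.exp (Complex.I * ((t : ℂ) + Complex.I) * s))
      (volume.prod (volume.restrict (Set.Ioi (0 : ℝ)))) := by
    have h1 : Integrable fun t : ℝ => (5 + |t|) ^ 0 * Real.exp (3 - 3 / 2 * t ^ 2) :=
      integrable_pow_mul_exp_neg_sq 0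
    have h2 : Integrable (fun s : ℝ => Real.exp (-s)) (volume.restrict (Set.Ioi (0 : ℝ))) :=
      integrableOn_exp_neg_Ioi 0
    refine (h1.mul_prod h2).mono' (Continuous.aestronglyMeasurable (by fun_prop))
      (Filter.Eventually.of_forall fun ⟨t, s⟩ => ?_)
    simp only [Function.uncurry, norm_mul, norm_cexp_neg_three_sq, pow_zero, one_mul]
    rw [Complex.norm_exp]
    gcongr
    · norm_num
    · simp
  have hinner : ∀ s : ℝ, ∫ t : ℝ, Complex.exp (-3 * ((t : ℂ) + Complex.I) ^ 2) *
      Complex.exp (Complex.I * ((t : ℂ) + Complex.I) * s) =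
      (Real.sqrt (Real.pi / 3) * Real.exp (-(1 / 12) * s ^ 2) : ℝ) := fun s => by
    push_cast
    rw [← integral_cexp_neg_three_mul_sq (1 - s / 6), ← integral_mul_const]
    congr 1 with t
    rw [← Complex.exp_add, ← Complex.exp_add]
    congr 1
    push_cast
    linear_combination (s ^ 2 / 12 : ℂ) * Complex.I_sq
  have : lineGaussian 2 = -Complex.I * ∫ t : ℝ, ∫ s in Set.Ioi (0 : ℝ),
      Complex.exp (-3 * ((t : ℂ) + Complex.I) ^ 2) *
        Complex.exp (Complex.I * ((t : ℂ) + Complex.I) * s) := by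
    unfold lineGaussian
    rw [← integral_const_mul]
    congr 1 with t
    rw [integral_const_mul, mul_left_comm (-Complex.I), ← hinv]
    have := ofReal_add_I_ne_zero t
    field_simp
  rw [this, integral_integral_swap hint]
  simp only [hinner]
  rw [integral_complex_ofReal, integral_const_mul, integral_gaussian_Ioi]
  congr 2
  rw [← mul_div_assoc, ← Real.sqrt_mul (by positivity),
    show Real.pi / 3 * (Real.pi / (1 / 12)) = (2 * Real.pi) ^ 2 by ring,
    Real.sqrt_sq (by positivity)]
  ring

lemma lineGaussian_eq (m : ℕ) (hm : 1 ≤ m) :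
    lineGaussian m = Complex.I * Complex.I⁻¹ ^ m *
      ((3 : ℝ) ^ ((m : ℝ) / 2 - 1) * (Real.pi / Real.Gamma ((m : ℝ) / 2)) : ℝ) := by
  induction m using Nat.twoStepInduction with
  | zero => omega
  | one =>
    rw [lineGaussian_one]
    have : Real.sqrt (Real.pi / 3) = (3 : ℝ) ^ (((1 : ℕ) : ℝ) / 2 - 1) *
        (Real.pi / Real.Gamma (((1 : ℕ) : ℝ) / 2)) := by
      rw [Nat.cast_one, Real.Gamma_one_half_eq, Real.div_sqrt, Real.sqrt_div (by positivity),
        show (1 : ℝ) / 2 - 1 = -(1 / 2) by norm_num, Real.rpow_neg (by norm_num),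
        ← Real.sqrt_eq_rpow]
      ring
    rw [this]
    simp
  | more p ih _ =>
    rcases Nat.eq_zero_or_pos p with rfl | hp
    · rw [lineGaussian_two]
      simp [pow_two]
    · have hrec := lineGaussian_add_two p
      rw [ih hp] at hrec
      have hp' : (p : ℂ) ≠ 0 := by exact_mod_cast hp.ne'
      apply mul_left_cancel₀ hp'
      rw [hrec]
      have hG : Real.Gamma (((p + 2 : ℕ) : ℝ) / 2) = (p : ℝ) / 2 * Real.Gamma ((p : ℝ) / 2) := by
        rw [← Real.Gamma_add_one (by positivity)]
        congr 1; push_cast; ring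
      have h3 : (3 : ℝ) ^ (((p + 2 : ℕ) : ℝ) / 2 - 1) = 3 * (3 : ℝ) ^ ((p : ℝ) / 2 - 1) := by
        rw [← Real.rpow_one_add' (by norm_num) (by
          have : (0 : ℝ) < p := by exact_mod_cast hp
          linarith)]
        congr 1; push_cast; ring
      have hG0 : (Real.Gamma ((p : ℝ) / 2) : ℂ) ≠ 0 := by
        exact_mod_cast (Real.Gamma_pos_of_pos (by positivity)).ne'
      rw [hG, h3, pow_add, Complex.inv_I]
      push_cast
      rw [neg_sq, Complex.I_sq]
      field_simp
      ring

/-- `(u - 2i)^r (u - 4i)^{1-n}`, the regular rational factor in the variable `u = y + 2i`. -/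
noncomputable def regularFactor (n r : ℕ) (u : ℂ) : ℂ :=
  (u - 2 * Complex.I) ^ r * ((u - 4 * Complex.I) * (u - 4 * Complex.I)⁻¹ ^ n)

/-- The derivative of `regularFactor n r`. -/
noncomputable def regularFactorDeriv (n r : ℕ) (u : ℂ) : ℂ :=
  r * (u - 2 * Complex.I) ^ (r - 1) * ((u - 4 * Complex.I) * (u - 4 * Complex.I)⁻¹ ^ n) +
    (u - 2 * Complex.I) ^ r * ((u - 4 * Complex.I)⁻¹ ^ n -
      n * (u - 4 * Complex.I)⁻¹ ^ (n - 1) * (u - 4 * Complex.I)⁻¹)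

lemma hasDerivAt_regularFactor (n r : ℕ) {u : ℂ} (hu : u - 4 * Complex.I ≠ 0) :
    HasDerivAt (regularFactor n r) (regularFactorDeriv n r u) u := by
  have h1 : HasDerivAt (fun u : ℂ => u - 2 * Complex.I) 1 u := (hasDerivAt_id u).sub_const _
  have h2 : HasDerivAt (fun u : ℂ => u - 4 * Complex.I) 1 u := (hasDerivAt_id u).sub_const _
  refine ((h1.pow r).mul (h2.mul ((h2.inv hu).pow n))).congr_deriv ?_
  simp only [Pi.pow_apply, Pi.inv_apply, Pi.mul_apply, regularFactorDeriv]
  field_simp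
  ring

lemma norm_regularFactor_le (n r : ℕ) {u : ℂ} {p : ℝ} (h2 : ‖u - 2 * Complex.I‖ ≤ p)
    (h4 : ‖u - 4 * Complex.I‖ ≤ p) (h1 : 1 ≤ ‖u - 4 * Complex.I‖) :
    ‖regularFactor n r u‖ ≤ p ^ (r + 1) := by
  have hp : 0 ≤ p := (norm_nonneg _).trans h2
  have hi : ‖(u - 4 * Complex.I)⁻¹‖ ^ n ≤ 1 :=
    pow_le_one₀ (norm_nonneg _) (by rw [norm_inv]; exact inv_le_one_of_one_le₀ h1)
  rw [regularFactor, norm_mul, norm_mul, norm_pow, norm_pow]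
  calc _ ≤ p ^ r * (p * 1) := by gcongr
    _ = _ := by ring

lemma norm_regularFactorDeriv_le (n r : ℕ) {u : ℂ} {p : ℝ} (h2 : ‖u - 2 * Complex.I‖ ≤ p)
    (h4 : ‖u - 4 * Complex.I‖ ≤ p) (h1 : 1 ≤ ‖u - 4 * Complex.I‖) :
    ‖regularFactorDeriv n r u‖ ≤ (r + n + 1) * p ^ (r + 1) := by
  have hp : 1 ≤ p := h1.trans h4
  have hi1 : ‖(u - 4 * Complex.I)⁻¹‖ ≤ 1 := by rw [norm_inv]; exact inv_le_one_of_one_le₀ h1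
  have hi : ∀ j : ℕ, ‖(u - 4 * Complex.I)⁻¹‖ ^ j ≤ 1 := fun j => pow_le_one₀ (norm_nonneg _) hi1
  have hq : p ^ (r - 1) * p ≤ p ^ (r + 1) := by
    rw [← pow_succ]; exact pow_le_pow_right₀ hp (by omega)
  have hq' : p ^ r ≤ p ^ (r + 1) := pow_le_pow_right₀ hp (by omega)
  have ha : ‖r * (u - 2 * Complex.I) ^ (r - 1) *
      ((u - 4 * Complex.I) * (u - 4 * Complex.I)⁻¹ ^ n)‖ ≤ r * p ^ (r - 1) * (p * 1) := by
    rw [norm_mul, norm_mul, norm_mul, norm_pow, norm_pow, Complex.norm_natCast]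
    have := hi n
    gcongr
  have hb : ‖(u - 2 * Complex.I) ^ r * ((u - 4 * Complex.I)⁻¹ ^ n -
      n * (u - 4 * Complex.I)⁻¹ ^ (n - 1) * (u - 4 * Complex.I)⁻¹)‖ ≤ p ^ r * (1 + n * 1 * 1) := by
    rw [norm_mul, norm_pow]
    gcongr
    refine (norm_sub_le _ _).trans ?_
    rw [norm_mul, norm_mul, norm_pow, norm_pow, Complex.norm_natCast]
    have h1 := hi n
    have h2 := hi (n - 1)
    gcongr
  calc _ ≤ r * p ^ (r - 1) * (p * 1) + p ^ r * (1 + n * 1 * 1) :=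
        (norm_add_le _ _).trans (add_le_add ha hb)
    _ = r * (p ^ (r - 1) * p) + p ^ r * (1 + n) := by ring
    _ ≤ r * p ^ (r + 1) + p ^ (r + 1) * (1 + n) := by gcongr
    _ = _ := by ring

/-- The integrand on the line `Im v = 1` after rescaling `u = ε v` with `ε = k^{-1/2}`. -/
noncomputable def scaledIntegrand (m n r : ℕ) (ε t : ℝ) : ℂ :=
  Complex.exp (-(3 * ((t : ℂ) + Complex.I) ^ 2 +
      Complex.I * ε * ((t : ℂ) + Complex.I) ^ 3 / 2)) *
    regularFactor n r (ε * ((t : ℂ) + Complex.I)) *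
    (((t : ℂ) + Complex.I) * ((t : ℂ) + Complex.I)⁻¹ ^ m)

lemma norm_cexp_phase_le {ε : ℝ} (hε : ε ∈ Set.Icc (0 : ℝ) 1) (t : ℝ) :
    ‖Complex.exp (-(3 * ((t : ℂ) + Complex.I) ^ 2 +
      Complex.I * ε * ((t : ℂ) + Complex.I) ^ 3 / 2))‖ ≤ Real.exp (3 - 3 / 2 * t ^ 2) := by
  rw [Complex.norm_exp]
  have : (-(3 * ((t : ℂ) + Complex.I) ^ 2 +
      Complex.I * ε * ((t : ℂ) + Complex.I) ^ 3 / 2)).re =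
      -3 * (t ^ 2 - 1) + ε * (3 * t ^ 2 - 1) / 2 := by
    simp [pow_succ]
    ring
  rw [this]
  gcongr
  nlinarith [hε.1, mul_nonneg (sub_nonneg.2 hε.2) (sq_nonneg t)]

lemma scaled_norm_bounds {ε : ℝ} (hε : ε ∈ Set.Icc (0 : ℝ) 1) (t : ℝ) :
    ‖ε * ((t : ℂ) + Complex.I) - 2 * Complex.I‖ ≤ 5 + |t| ∧
    ‖ε * ((t : ℂ) + Complex.I) - 4 * Complex.I‖ ≤ 5 + |t| ∧
    1 ≤ ‖ε * ((t : ℂ) + Complex.I) - 4 * Complex.I‖ := by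
  have hv : ‖ε * ((t : ℂ) + Complex.I)‖ ≤ 1 + |t| := by
    rw [norm_mul, Complex.norm_real, Real.norm_of_nonneg hε.1]
    calc _ ≤ 1 * (1 + |t|) := by
          gcongr
          · exact hε.2
          · exact norm_ofReal_add_I_le t
      _ = _ := one_mul _
  refine ⟨(norm_sub_le _ _).trans ?_, (norm_sub_le _ _).trans ?_, ?_⟩
  · simp only [norm_mul, Complex.norm_I, Complex.norm_ofNat] at *; linarith
  · simp only [norm_mul, Complex.norm_I, Complex.norm_ofNat] at *; linarith
  · refine le_trans ?_ (Complex.abs_im_le_norm _)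
    have : (ε * ((t : ℂ) + Complex.I) - 4 * Complex.I).im = ε - 4 := by simp
    rw [this, abs_of_nonpos (by linarith [hε.2])]
    linarith [hε.2]

lemma norm_scaledIntegrand_sub_le (m n r : ℕ) {ε : ℝ} (hε : ε ∈ Set.Icc (0 : ℝ) 1) (t : ℝ) :
    ‖scaledIntegrand m n r ε t - scaledIntegrand m n r 0 t‖ ≤
      (r + n + 2) * ((5 + |t|) ^ (r + 5) * Real.exp (3 - 3 / 2 * t ^ 2)) * ε := by
  set v : ℂ := (t : ℂ) + Complex.I with hv
  have hderiv : ∀ x ∈ Set.Icc (0 : ℝ) 1, HasDerivWithinAt (fun x => scaledIntegrand m n r x t)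
      ((Complex.exp (-(3 * v ^ 2 + Complex.I * x * v ^ 3 / 2)) * (-(Complex.I * v ^ 3 / 2)) *
          regularFactor n r (x * v) +
        Complex.exp (-(3 * v ^ 2 + Complex.I * x * v ^ 3 / 2)) *
          (regularFactorDeriv n r (x * v) * v)) * (v * v⁻¹ ^ m)) (Set.Icc 0 1) x := fun x hx => by
    have hx1 : HasDerivAt (fun x : ℝ => (x : ℂ)) 1 x := Complex.ofRealCLM.hasDerivAt
    have h4 : (x : ℂ) * v - 4 * Complex.I ≠ 0 :=
      norm_pos_iff.1 (one_pos.trans_le (scaled_norm_bounds hx t).2.2)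
    have he : HasDerivAt (fun x : ℝ => -(3 * v ^ 2 + Complex.I * x * v ^ 3 / 2))
        (-(Complex.I * v ^ 3 / 2)) x := by
      refine (((((hx1.const_mul Complex.I).mul_const (v ^ 3)).div_const 2).const_add
        (3 * v ^ 2)).neg).congr_deriv ?_
      ring
    have hr : HasDerivAt (fun x : ℝ => regularFactor n r (x * v))
        (regularFactorDeriv n r (x * v) * v) x := by
      have := HasDerivAt.comp (h₂ := regularFactor n r) x (hasDerivAt_regularFactor n r h4)
        (hx1.mul_const v)
      rw [one_mul] at this
      exact this
    exact ((he.cexp.mul hr).mul_const _).hasDerivWithinAt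
  have hbound : ∀ x ∈ Set.Icc (0 : ℝ) 1,
      ‖(Complex.exp (-(3 * v ^ 2 + Complex.I * x * v ^ 3 / 2)) * (-(Complex.I * v ^ 3 / 2)) *
          regularFactor n r (x * v) +
        Complex.exp (-(3 * v ^ 2 + Complex.I * x * v ^ 3 / 2)) *
          (regularFactorDeriv n r (x * v) * v)) * (v * v⁻¹ ^ m)‖ ≤
      (r + n + 2) * ((5 + |t|) ^ (r + 5) * Real.exp (3 - 3 / 2 * t ^ 2)) := fun x hx => by
    obtain ⟨h2, h4, h1⟩ := scaled_norm_bounds hx t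
    have hE := norm_cexp_phase_le hx t
    rw [← hv] at h2 h4 h1 hE
    have hS := norm_regularFactor_le n r h2 h4 h1
    have hS' := norm_regularFactorDeriv_le n r h2 h4 h1
    have hvp : ‖v‖ ≤ 5 + |t| := (norm_ofReal_add_I_le t).trans (by linarith)
    have hinv : ‖v⁻¹‖ ^ m ≤ 1 := pow_le_one₀ (norm_nonneg _) (norm_inv_ofReal_add_I_le t)
    have hp : 1 ≤ 5 + |t| := by linarith [abs_nonneg t]
    have hv3 : ‖-(Complex.I * v ^ 3 / 2)‖ ≤ (5 + |t|) ^ 3 := by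
      rw [norm_neg, norm_div, norm_mul, norm_pow, Complex.norm_I, one_mul, Complex.norm_ofNat]
      exact (half_le_self (by positivity)).trans (by gcongr)
    generalize 5 + |t| = p at *
    generalize Real.exp (3 - 3 / 2 * t ^ 2) = E at *
    have hp0 : 0 ≤ p := zero_le_one.trans hp
    have hE0 : 0 ≤ E := (norm_nonneg _).trans hE
    rw [norm_mul, norm_mul v, norm_pow]
    calc _ ≤ (E * p ^ 3 * p ^ (r + 1) + E * ((r + n + 1) * p ^ (r + 1) * p)) * (p * 1) := by
          gcongr
          refine (norm_add_le _ _).trans ?_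
          rw [norm_mul, norm_mul, norm_mul, norm_mul]
          gcongr
      _ = E * p ^ (r + 5) + E * (r + n + 1) * p ^ (r + 3) := by ring
      _ ≤ E * p ^ (r + 5) + E * (r + n + 1) * p ^ (r + 5) := by
          gcongr
          norm_num
      _ = _ := by ring
  have := (convex_Icc (0 : ℝ) 1).norm_image_sub_le_of_norm_hasDerivWithin_le hderiv hbound
    (Set.left_mem_Icc.2 zero_le_one) hε
  rwa [sub_zero, Real.norm_of_nonneg hε.1] at this

lemma integral_scaledIntegrand_zero (m n r : ℕ) :
    ∫ t, scaledIntegrand m n r 0 t = regularFactor n r 0 * lineGaussian m := by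
  unfold lineGaussian
  rw [← integral_const_mul]
  congr 1 with t
  simp only [scaledIntegrand, Complex.ofReal_zero, mul_zero, zero_mul, zero_div, add_zero, neg_mul]
  ring

lemma continuous_scaledIntegrand (m n r : ℕ) {ε : ℝ} (hε : ε ∈ Set.Icc (0 : ℝ) 1) :
    Continuous (scaledIntegrand m n r ε) := by
  have h1 : Continuous fun t : ℝ => ((t : ℂ) + Complex.I)⁻¹ :=
    Continuous.inv₀ (by fun_prop) ofReal_add_I_ne_zero
  have h2 : Continuous fun t : ℝ => (ε * ((t : ℂ) + Complex.I) - 4 * Complex.I)⁻¹ :=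
    Continuous.inv₀ (by fun_prop) fun t =>
      norm_pos_iff.1 (one_pos.trans_le (scaled_norm_bounds hε t).2.2)
  unfold scaledIntegrand regularFactor
  fun_prop

lemma exists_norm_integral_scaledIntegrand_sub_le (m n r : ℕ) :
    ∃ M > (0 : ℝ), ∀ ε ∈ Set.Icc (0 : ℝ) 1,
      ‖(∫ t, scaledIntegrand m n r ε t) - regularFactor n r 0 * lineGaussian m‖ ≤ M * ε := by
  have hB : Integrable fun t : ℝ =>
      (r + n + 2) * ((5 + |t|) ^ (r + 5) * Real.exp (3 - 3 / 2 * t ^ 2)) :=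
    (integrable_pow_mul_exp_neg_sq (r + 5)).const_mul _
  have h0 : Integrable (scaledIntegrand m n r 0) := by
    have := (integrable_gaussian_mul_inv_pow m 1).const_mul (regularFactor n r 0)
    refine this.congr (Filter.Eventually.of_forall fun t => ?_)
    simp only [scaledIntegrand, Complex.ofReal_zero, mul_zero, zero_mul, zero_div, add_zero,
      neg_mul, pow_one]
    ring
  refine ⟨(∫ t : ℝ, (r + n + 2) * ((5 + |t|) ^ (r + 5) * Real.exp (3 - 3 / 2 * t ^ 2))) + 1,
    add_pos_of_nonneg_of_pos (integral_nonneg fun t => by positivity) one_pos, fun ε hε => ?_⟩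
  have hd : Integrable fun t => scaledIntegrand m n r ε t - scaledIntegrand m n r 0 t :=
    (hB.mul_const ε).mono' ((continuous_scaledIntegrand m n r hε).aestronglyMeasurable.sub
      h0.aestronglyMeasurable)
      (Filter.Eventually.of_forall fun t => norm_scaledIntegrand_sub_le m n r hε t)
  have hε' : Integrable (scaledIntegrand m n r ε) := by
    refine (hd.add h0).congr (Filter.Eventually.of_forall fun t => ?_)
    simp
  rw [← integral_scaledIntegrand_zero, ← integral_sub hε' h0]
  calc _ ≤ ∫ t : ℝ, (r + n + 2) * ((5 + |t|) ^ (r + 5) * Real.exp (3 - 3 / 2 * t ^ 2)) * ε :=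
        norm_integral_le_of_norm_le (hB.mul_const ε)
          (Filter.Eventually.of_forall fun t => norm_scaledIntegrand_sub_le m n r hε t)
    _ = (∫ t : ℝ, (r + n + 2) * ((5 + |t|) ^ (r + 5) * Real.exp (3 - 3 / 2 * t ^ 2))) * ε :=
        integral_mul_const _ _
    _ ≤ _ := by
        have := hε.1
        gcongr
        linarith

/-- The integrand in the variable `w = y + 2i`, up to the factor `(3/2) e^{-8k}`. -/
noncomputable def shiftedIntegrand (m n r : ℕ) (k : ℝ) (w : ℂ) : ℂ :=
  Complex.exp (-(k * (3 * w ^ 2 + Complex.I * w ^ 3 / 2))) * regularFactor n r w * (w * w⁻¹ ^ m)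

lemma differentiableOn_shiftedIntegrand (m n r : ℕ) (k : ℝ) {δ : ℝ} (hδ : 0 < δ) :
    DifferentiableOn ℂ (shiftedIntegrand m n r k) (Complex.im ⁻¹' Set.Icc δ 2) := fun w hw => by
  have hw0 : w ≠ 0 := by
    rintro rfl
    simpa using hδ.trans_le hw.1
  have hw4 : w - 4 * Complex.I ≠ 0 := fun h => by
    have := congrArg Complex.im h
    simp only [Complex.sub_im, Complex.mul_im, Complex.re_ofNat, Complex.im_ofNat, Complex.I_im,
      Complex.I_re, Complex.zero_im] at this
    linarith [hw.2]
  have hr := (hasDerivAt_regularFactor n r hw4).differentiableAt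
  have hi : DifferentiableAt ℂ (fun w : ℂ => w⁻¹) w := differentiableAt_inv hw0
  refine DifferentiableAt.differentiableWithinAt ?_
  unfold shiftedIntegrand
  fun_prop

lemma norm_shiftedIntegrand_le {m n r : ℕ} (hmn : r + 4 ≤ m + n) {k δ : ℝ} (hk : 0 ≤ k)
    (hδ : 0 < δ) (x : ℝ) {s : ℝ} (hs : s ∈ Set.Icc δ 2) :
    ‖shiftedIntegrand m n r k (x + s * Complex.I)‖ ≤
      Real.exp (12 * k) * (1 + 4 / δ) ^ m * (1 + x ^ 2)⁻¹ := by
  obtain ⟨hs1, hs2⟩ := hs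
  have hs0 : 0 < s := hδ.trans_le hs1
  have hexp : ‖Complex.exp (-(k * (3 * ((x : ℂ) + s * Complex.I) ^ 2 +
      Complex.I * ((x : ℂ) + s * Complex.I) ^ 3 / 2)))‖ ≤ Real.exp (12 * k) := by
    rw [Complex.norm_exp]
    have : (-(k * (3 * ((x : ℂ) + s * Complex.I) ^ 2 +
        Complex.I * ((x : ℂ) + s * Complex.I) ^ 3 / 2))).re =
        k * (-3 * x ^ 2 * (1 - s / 2) + 3 * s ^ 2 - s ^ 3 / 2) := by
      simp [pow_succ]
      ring
    rw [this, mul_comm 12 k]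
    gcongr
    have h1 : 0 ≤ x ^ 2 * (1 - s / 2) := mul_nonneg (sq_nonneg x) (by linarith)
    have h2 : 0 ≤ s ^ 3 := by positivity
    nlinarith
  have hsq : ∀ c : ℝ, ‖(x : ℂ) + s * Complex.I - c * Complex.I‖ ^ 2 = x ^ 2 + (s - c) ^ 2 :=
    fun c => by
      rw [← Complex.normSq_eq_norm_sq, Complex.normSq_apply]
      simp
      ring
  have hq0 := hsq 0
  have hq2 := hsq 2
  have hq4 := hsq 4
  push_cast at hq0 hq2 hq4
  rw [zero_mul, sub_zero] at hq0
  unfold shiftedIntegrand regularFactor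
  generalize Complex.exp (-(k * (3 * ((x : ℂ) + s * Complex.I) ^ 2 +
      Complex.I * ((x : ℂ) + s * Complex.I) ^ 3 / 2))) = E at *
  have hw4 : ‖(x : ℂ) + s * Complex.I - 4 * Complex.I‖ ≤ (1 + 4 / δ) * ‖(x : ℂ) + s * Complex.I‖ := by
    have h1 : δ ≤ ‖(x : ℂ) + s * Complex.I‖ := by
      refine abs_le_of_sq_le_sq' ?_ (norm_nonneg _) |>.2
      rw [hq0]; nlinarith [sq_nonneg x]
    have h2 : ‖(x : ℂ) + s * Complex.I - 4 * Complex.I‖ ≤ ‖(x : ℂ) + s * Complex.I‖ + 4 := by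
      refine (norm_sub_le _ _).trans ?_
      simp
    have h3 : 4 ≤ 4 / δ * ‖(x : ℂ) + s * Complex.I‖ := by
      rw [div_mul_eq_mul_div, le_div_iff₀ hδ]; linarith
    linarith
  simp only [norm_mul, norm_pow, norm_inv]
  have hw0 : 0 < ‖(x : ℂ) + s * Complex.I‖ :=
    (sq_pos_iff.1 (by rw [hq0]; positivity)).lt_of_le' (norm_nonneg _)
  generalize ‖(x : ℂ) + s * Complex.I‖ = w at *
  have h2n := norm_nonneg ((x : ℂ) + s * Complex.I - 2 * Complex.I)
  have h4n := norm_nonneg ((x : ℂ) + s * Complex.I - 4 * Complex.I)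
  generalize ‖(x : ℂ) + s * Complex.I - 2 * Complex.I‖ = a at *
  generalize ‖(x : ℂ) + s * Complex.I - 4 * Complex.I‖ = q at *
  have hq1 : 1 ≤ q := by nlinarith [sq_nonneg x]
  have hq0' : 0 < q := one_pos.trans_le hq1
  have haq : a ≤ q := by
    refine abs_le_of_sq_le_sq' ?_ h4n |>.2
    rw [hq2, hq4]; nlinarith
  have hwq : w ≤ q := by
    refine abs_le_of_sq_le_sq' ?_ h4n |>.2
    rw [hq0, hq4]; nlinarith
  have hxq : 1 + x ^ 2 ≤ q ^ 2 := by rw [hq4]; nlinarith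
  have hK : 0 < 1 + 4 / δ := by positivity
  have hwinv : w⁻¹ ≤ (1 + 4 / δ) * q⁻¹ := by
    rw [← div_eq_mul_inv, le_div_iff₀ hq0', inv_mul_le_iff₀ hw0]
    linarith
  have hqpow : q ^ (r + 4) ≤ q ^ (m + n) := pow_le_pow_right₀ hq1 hmn
  have hmain : q ^ r * (q * q⁻¹ ^ n) * (q * ((1 + 4 / δ) * q⁻¹) ^ m) ≤
      (1 + 4 / δ) ^ m * (1 + x ^ 2)⁻¹ := by
    have h1 : q ^ r * (q * q⁻¹ ^ n) * (q * ((1 + 4 / δ) * q⁻¹) ^ m) =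
        (1 + 4 / δ) ^ m * (q ^ (r + 2) / q ^ (m + n)) := by
      rw [mul_pow, inv_pow, inv_pow]
      field_simp
      ring
    rw [h1]
    gcongr
    rw [div_le_iff₀ (by positivity), ← div_eq_inv_mul, le_div_iff₀ (by positivity)]
    calc q ^ (r + 2) * (1 + x ^ 2) ≤ q ^ (r + 2) * q ^ 2 := by gcongr
      _ = q ^ (r + 4) := by ring
      _ ≤ _ := hqpow
  calc _ ≤ Real.exp (12 * k) * (q ^ r * (q * q⁻¹ ^ n)) * (q * ((1 + 4 / δ) * q⁻¹) ^ m) := by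
        gcongr
    _ = Real.exp (12 * k) * (q ^ r * (q * q⁻¹ ^ n) * (q * ((1 + 4 / δ) * q⁻¹) ^ m)) := by ring
    _ ≤ Real.exp (12 * k) * ((1 + 4 / δ) ^ m * (1 + x ^ 2)⁻¹) := by gcongr
    _ = _ := by ring

lemma integral_eq_integral_shiftedIntegrand (m n r : ℕ) (k : ℝ) :
    (∫ z : ℝ, Complex.exp (-(Complex.I * (k : ℂ) * (z : ℂ))) * (yy z : ℂ) ^ r *
      ((yy z : ℂ) + 2 * Complex.I) ^ (-(m : ℤ)) * ((yy z : ℂ) - 2 * Complex.I) ^ (-(n : ℤ))) =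
    3 / 2 * Complex.exp (-8 * k) *
      ∫ x : ℝ, shiftedIntegrand m n r k (x + (2 : ℝ) * Complex.I) := by
  rw [integral_comp_yy fun z y => Complex.exp (-(Complex.I * (k : ℂ) * (z : ℂ))) * (y : ℂ) ^ r *
      ((y : ℂ) + 2 * Complex.I) ^ (-(m : ℤ)) * ((y : ℂ) - 2 * Complex.I) ^ (-(n : ℤ)),
    ← integral_const_mul]
  congr 1 with y
  unfold shiftedIntegrand regularFactor
  have he : Complex.exp (-(Complex.I * k * (((y ^ 3 + 12 * y) / 2 : ℝ) : ℂ))) =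
      Complex.exp (-8 * k) * Complex.exp (-(k * (3 * ((y : ℂ) + (2 : ℝ) * Complex.I) ^ 2 +
        Complex.I * ((y : ℂ) + (2 : ℝ) * Complex.I) ^ 3 / 2))) := by
    rw [← Complex.exp_add]
    congr 1
    push_cast
    linear_combination (k : ℂ) * (3 * y ^ 2 + 6 * y * Complex.I + 4 * Complex.I ^ 2 + 8) *
      Complex.I_sq
  rw [he]
  push_cast
  rw [show (y : ℂ) + 2 * Complex.I - 2 * Complex.I = y by ring,
    show (y : ℂ) + 2 * Complex.I - 4 * Complex.I = y - 2 * Complex.I by ring,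
    show (y : ℂ) ^ 2 + 4 = (y + 2 * Complex.I) * (y - 2 * Complex.I) by
      linear_combination 4 * Complex.I_sq,
    zpow_neg, zpow_neg, zpow_natCast, zpow_natCast, inv_pow, inv_pow]
  ring

lemma integral_shiftedIntegrand_eq {m n r : ℕ} (hmn : r + 4 ≤ m + n) {k δ : ℝ} (hk : 0 ≤ k)
    (hδ : 0 < δ) (hδ1 : δ ≤ 1) (hkδ : k * δ ^ 2 = 1) :
    ∫ x : ℝ, shiftedIntegrand m n r k (x + (2 : ℝ) * Complex.I) =
      ((δ ^ 2 * δ⁻¹ ^ m : ℝ) : ℂ) * ∫ t, scaledIntegrand m n r δ t := by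
  rw [← integral_horizontal_line_eq (by linarith) (differentiableOn_shiftedIntegrand m n r k hδ)
    fun x s hs => norm_shiftedIntegrand_le hmn hk hδ x hs]
  have hscale := Measure.integral_comp_mul_left
    (fun x : ℝ => shiftedIntegrand m n r k (x + δ * Complex.I)) δ
  have hδ0 : (δ : ℂ) ≠ 0 := by exact_mod_cast hδ.ne'
  have hkδ' : (k : ℂ) * δ ^ 2 = 1 := by exact_mod_cast hkδ
  have hpt : ∀ t : ℝ, shiftedIntegrand m n r k (((δ * t : ℝ) : ℂ) + δ * Complex.I) =
      ((δ * δ⁻¹ ^ m : ℝ) : ℂ) * scaledIntegrand m n r δ t := fun t => by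
    unfold shiftedIntegrand scaledIntegrand
    rw [show ((δ * t : ℝ) : ℂ) + δ * Complex.I = δ * ((t : ℂ) + Complex.I) by push_cast; ring]
    generalize (t : ℂ) + Complex.I = v
    rw [show -((k : ℂ) * (3 * (δ * v) ^ 2 + Complex.I * (δ * v) ^ 3 / 2)) =
      -(3 * v ^ 2 + Complex.I * δ * v ^ 3 / 2) by
        linear_combination -(3 * v ^ 2 + Complex.I * δ * v ^ 3 / 2) * hkδ', mul_inv, mul_pow]
    push_cast
    ring
  simp only [hpt] at hscale
  rw [integral_const_mul, abs_of_pos (inv_pos.2 hδ), Complex.real_smul] at hscale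
  have : ∫ x : ℝ, shiftedIntegrand m n r k (x + δ * Complex.I) =
      δ * (((δ⁻¹ : ℝ) : ℂ) * ∫ x : ℝ, shiftedIntegrand m n r k (x + δ * Complex.I)) := by
    push_cast
    field_simp
  rw [this, ← hscale]
  push_cast
  ring

lemma leading_coefficient_eq (m n r : ℕ) (hm : 1 ≤ m) :
    3 / 2 * (regularFactor n r 0 * lineGaussian m) =
      Complex.I ^ (3 * ((r : ℤ) - (n : ℤ)) - (m : ℤ)) * (2 : ℂ) ^ ((r : ℤ) - 2 * (n : ℤ) + 1) *
        ((3 : ℝ) ^ ((m : ℝ) / 2) * (Real.pi / Real.Gamma ((m : ℝ) / 2)) : ℝ) := by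
  have hI : Complex.I ^ (3 * ((r : ℤ) - (n : ℤ)) - (m : ℤ)) =
      (-Complex.I) ^ r * Complex.I ^ n * Complex.I⁻¹ ^ m := by
    rw [zpow_sub₀ Complex.I_ne_zero, zpow_mul, zpow_natCast, zpow_ofNat, Complex.I_pow_three,
      zpow_sub₀ (neg_ne_zero.2 Complex.I_ne_zero), zpow_natCast, zpow_natCast, div_eq_mul_inv,
      div_eq_mul_inv, ← inv_pow, ← inv_pow, inv_neg, Complex.inv_I, neg_neg]
  have h2 : (2 : ℂ) ^ ((r : ℤ) - 2 * (n : ℤ) + 1) = 2 ^ r * (4⁻¹) ^ n * 2 := by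
    rw [zpow_add₀ two_ne_zero, zpow_sub₀ two_ne_zero, zpow_mul, zpow_natCast, zpow_natCast,
      zpow_ofNat, zpow_one, div_eq_mul_inv, ← inv_pow]
    norm_num
  have h4 : (0 - 4 * Complex.I)⁻¹ = Complex.I * 4⁻¹ := by
    rw [zero_sub, inv_neg, mul_inv, Complex.inv_I]; ring
  have h3 : (3 : ℝ) ^ ((m : ℝ) / 2 - 1) = (3 : ℝ) ^ ((m : ℝ) / 2) / 3 :=
    Real.rpow_sub_one (by norm_num) _
  rw [lineGaussian_eq m hm, regularFactor, hI, h2, h4, h3, mul_pow,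
    show (0 : ℂ) - 2 * Complex.I = -Complex.I * 2 by ring, mul_pow]
  push_cast
  linear_combination (-2 * (-Complex.I) ^ r * 2 ^ r * Complex.I ^ n * 4⁻¹ ^ n * Complex.I⁻¹ ^ m *
    (((3 : ℝ) ^ ((m : ℝ) / 2) : ℝ) : ℂ) * (Real.pi / (Real.Gamma ((m : ℝ) / 2) : ℂ))) *
      Complex.I_sq

/-- Asymptotics of `𝓘_{m,n,r}(k) = ∫ e^{−ikz} y(z)^r (y(z)+2i)^{−m}(y(z)−2i)^{−n} dz`
as `k → ∞`:
`𝓘_{m,n,r}(k) = i^{3(r−n)−m} 2^{r−2n+1} 3^{m/2} (π/Γ(m/2)) e^{−8k} k^{(m−2)/2}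
              + O(k^{(m−3)/2} e^{−8k})`. -/
theorem watson_asymptotics
    (m n r : ℕ) (hm : 1 ≤ m) (hmn : r + 4 ≤ m + n) :
    ∃ C > (0 : ℝ), ∃ k₀ > (0 : ℝ), ∀ k : ℝ, k₀ ≤ k →
      ‖(∫ z : ℝ,
            Complex.exp (-(Complex.I * (k : ℂ) * (z : ℂ))) * (yy z : ℂ) ^ r *
              ((yy z : ℂ) + 2 * Complex.I) ^ (-(m : ℤ)) *
              ((yy z : ℂ) - 2 * Complex.I) ^ (-(n : ℤ)))
          - Complex.I ^ (3 * ((r : ℤ) - (n : ℤ)) - (m : ℤ)) *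
              (2 : ℂ) ^ ((r : ℤ) - 2 * (n : ℤ) + 1) *
              (((3 : ℝ) ^ ((m : ℝ) / 2) * (Real.pi / Real.Gamma ((m : ℝ) / 2)) *
                  Real.exp (-8 * k) * k ^ (((m : ℝ) - 2) / 2) : ℝ) : ℂ)‖
        ≤ C * k ^ (((m : ℝ) - 3) / 2) * Real.exp (-8 * k) := by
  obtain ⟨M, hM, hbound⟩ := exists_norm_integral_scaledIntegrand_sub_le m n r
  refine ⟨3 / 2 * M, by positivity, 1, one_pos, fun k hk => ?_⟩
  have hk0 : 0 < k := one_pos.trans_le hk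
  have hδ : 0 < k ^ (-(1 / 2) : ℝ) := Real.rpow_pos_of_pos hk0 _
  have hδ1 : k ^ (-(1 / 2) : ℝ) ≤ 1 := Real.rpow_le_one_of_one_le_of_nonpos hk (by norm_num)
  have hpow : ∀ j : ℕ, (k ^ (-(1 / 2) : ℝ)) ^ j * (k ^ (-(1 / 2) : ℝ))⁻¹ ^ m =
      k ^ (((m : ℝ) - j) / 2) := fun j => by
    rw [← Real.rpow_neg hk0.le, ← Real.rpow_mul_natCast hk0.le, ← Real.rpow_mul_natCast hk0.le,
      ← Real.rpow_add hk0]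
    congr 1; ring
  have hkδ : k * (k ^ (-(1 / 2) : ℝ)) ^ 2 = 1 := by
    rw [← Real.rpow_mul_natCast hk0.le, show (-(1 / 2) : ℝ) * (2 : ℕ) = -1 by norm_num,
      Real.rpow_neg_one, mul_inv_cancel₀ hk0.ne']
  have hp2 := hpow 2
  have hp3 := hpow 3
  push_cast at hp2 hp3
  rw [integral_eq_integral_shiftedIntegrand, integral_shiftedIntegrand_eq hmn hk0.le hδ hδ1 hkδ,
    ← hp2, ← hp3]
  generalize k ^ (-(1 / 2) : ℝ) = δ at *
  have hcoef := leading_coefficient_eq m n r hm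
  push_cast at hcoef
  have hdiff : 3 / 2 * Complex.exp (-8 * k) * (((δ ^ 2 * δ⁻¹ ^ m : ℝ) : ℂ) *
        ∫ t, scaledIntegrand m n r δ t) -
      Complex.I ^ (3 * ((r : ℤ) - (n : ℤ)) - (m : ℤ)) * (2 : ℂ) ^ ((r : ℤ) - 2 * (n : ℤ) + 1) *
        (((3 : ℝ) ^ ((m : ℝ) / 2) * (Real.pi / Real.Gamma ((m : ℝ) / 2)) *
          Real.exp (-8 * k) * (δ ^ 2 * δ⁻¹ ^ m) : ℝ) : ℂ) =
      ((3 / 2 * Real.exp (-8 * k) * (δ ^ 2 * δ⁻¹ ^ m) : ℝ) : ℂ) *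
        ((∫ t, scaledIntegrand m n r δ t) - regularFactor n r 0 * lineGaussian m) := by
    push_cast
    linear_combination (Complex.exp (-8 * k) * (δ ^ 2 * (δ : ℂ)⁻¹ ^ m)) * hcoef
  rw [hdiff, norm_mul, Complex.norm_real, Real.norm_of_nonneg (by positivity)]
  calc _ ≤ 3 / 2 * Real.exp (-8 * k) * (δ ^ 2 * δ⁻¹ ^ m) * (M * δ) := by
        gcongr
        exact hbound δ ⟨hδ.le, hδ1⟩
    _ = _ := by ring
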